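/- Let 𝒞 be a finite family of convex sets in ℝ^d. If for every subfamily 𝒞* ⊆ 𝒞 of size at most 2d the intersection ⋂𝒞* contains a halfline (a set of the form {u + t·v : t ≥ 0} with v ≠ 0), then ⋂𝒞 contains a halfline. -/

import Mathlib

open Filter Topology

theorem kh_partner {ι V E : Type*} [Fintype ι] [AddCommGroup V] [Module ℝ V]
    [AddCommGroup E] [Module ℝ E] (l : ι → V →ₗ[ℝ] ℝ) (x : ι → E) (hx : ∀ i, x i ≠ 0)
    (hf : ∀ a, ∑ i, |l i a| • x i = 0) (i : ι) (hi : l i ≠ 0) :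
    ∃ j, j ≠ i ∧ l j ≠ 0 ∧ ∃ c : ℝ, l j = c • l i := by
  classical
  by_contra! h
  obtain ⟨a, ha, haj⟩ : ∃ a, l i a = 0 ∧ ∀ j, j ≠ i → l j ≠ 0 → l j a ≠ 0 := by
    by_contra! hc
    obtain ⟨j, hj⟩ := Subspace.exists_eq_top_of_iUnion_eq_univ (k := ℝ)
      (p := fun j : {j // j ≠ i ∧ l j ≠ 0} =>
        LinearMap.ker ((l j).comp (LinearMap.ker (l i)).subtype)) (by
        ext ⟨a, ha⟩
        obtain ⟨j, h1, h2, h3⟩ := hc a ha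
        simp only [Set.mem_iUnion, Set.mem_univ, iff_true]
        exact ⟨⟨j, h1, h2⟩, by simpa using h3⟩)
    have hle : LinearMap.ker (l i) ≤ LinearMap.ker (l j.1) := by
      intro a ha
      have : (⟨a, ha⟩ : LinearMap.ker (l i)) ∈
        LinearMap.ker ((l j.1).comp (LinearMap.ker (l i)).subtype) := by rw [hj]; trivial
      simpa using this
    have := mem_span_of_iInf_ker_le_ker (L := fun _ : Unit => l i) (K := l j.1) (by simpa using hle)
    rw [Set.range_const, Submodule.mem_span_singleton] at this
    obtain ⟨c, hc⟩ := this
    exact h j.1 j.2.1 j.2.2 c hc.symm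
  obtain ⟨b, hb⟩ : ∃ b, l i b = 1 := by
    obtain ⟨b, hb⟩ : ∃ b, l i b ≠ 0 := by
      by_contra! hc
      exact hi (LinearMap.ext hc)
    exact ⟨(l i b)⁻¹ • b, by simp [hb]⟩
  set T : ℝ := ∑ j, |l j b| / |l j a| with hT
  have hT0 : 0 ≤ T := Finset.sum_nonneg fun j _ => by positivity
  have key : ∀ j, j ≠ i → |l j (T • a + b)| + |l j (T • a - b)| = 2 * |l j (T • a)| := by
    intro j hj
    by_cases h0 : l j = 0
    · simp [h0]
    have hja := haj j hj h0
    have h1 : |l j b| / |l j a| ≤ T :=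
      Finset.single_le_sum (f := fun j => |l j b| / |l j a|) (fun j _ => by positivity)
        (Finset.mem_univ j)
    rw [div_le_iff₀ (abs_pos.mpr hja)] at h1
    simp only [map_add, map_sub, map_smul, smul_eq_mul]
    have h2 : |l j b| ≤ |T * l j a| := by rwa [abs_mul, abs_of_nonneg hT0]
    rcases abs_cases (l j b) with h3 | h3 <;> rcases abs_cases (T * l j a) with h4 | h4 <;>
    rcases abs_cases (T * l j a + l j b) with h5 | h5 <;>
    rcases abs_cases (T * l j a - l j b) with h6 | h6 <;> linarith
  have h1 := hf (T • a + b)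
  have h2 := hf (T • a - b)
  have h3 := hf (T • a)
  have h4 : ∑ j, (|l j (T • a + b)| + |l j (T • a - b)| - 2 * |l j (T • a)|) • x j = 0 := by
    simp only [sub_smul, add_smul, mul_smul, Finset.sum_sub_distrib, Finset.sum_add_distrib, h1, h2,
      ← Finset.smul_sum, h3]
    simp
  rw [Finset.sum_eq_single i] at h4
  · simp [ha, hb] at h4
    exact hx i h4
  · intro j _ hj
    rw [key j hj]; simp
  · simp

theorem kh_count {ι V E : Type*} [Fintype ι] [AddCommGroup V] [Module ℝ V] [FiniteDimensional ℝ V]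
    [AddCommGroup E] [Module ℝ E] (l : ι → V →ₗ[ℝ] ℝ) (x : ι → E) (hx : ∀ i, x i ≠ 0)
    (hl : ∀ a, (∀ i, l i a = 0) → a = 0)
    (hf : ∀ a, ∑ i, |l i a| • x i = 0) : 2 * Module.finrank ℝ V ≤ Fintype.card ι := by
  classical
  obtain ⟨κ, r, hr, hsp, hli⟩ := exists_linearIndependent' ℝ l
  have hfin : Finite κ := Finite.of_injective r hr
  have := Fintype.ofFinite κ
  have hspan : ⊤ ≤ Submodule.span ℝ (Set.range l) := by
    intro K _
    refine mem_span_of_iInf_ker_le_ker ?_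
    intro a ha
    have : a = 0 := hl a (by simpa using ha)
    simp [this]
  have hcard : Fintype.card κ = Module.finrank ℝ V := by
    have b := Module.Basis.mk hli (by rw [hsp]; exact hspan)
    rw [← Module.finrank_eq_card_basis b]
    exact Subspace.dual_finrank_eq
  have hne : ∀ k, l (r k) ≠ 0 := fun k => hli.ne_zero k
  choose s hs1 hs2 c hs3 using fun k => kh_partner l x hx hf (r k) (hne k)
  have hc : ∀ k, c k ≠ 0 := by
    intro k h; apply hs2 k; rw [hs3, h, zero_smul]
  have hpar : ∀ k k' : κ, ∀ e : ℝ, e ≠ 0 → l (r k) = e • l (r k') → k = k' := by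
    intro k k' e he h
    by_contra hne'
    refine hli.notMem_span_image (s := {k'}) (x := k) (by simpa using hne') ?_
    simp only [Set.image_singleton, Submodule.mem_span_singleton, Function.comp]
    exact ⟨e, h.symm⟩
  have hinj : Function.Injective (Sum.elim r s) := by
    refine Function.Injective.sumElim hr ?_ ?_
    · intro k k' h
      refine hpar k k' ((c k)⁻¹ * c k') (mul_ne_zero (inv_ne_zero (hc k)) (hc k')) ?_
      rw [mul_smul, ← hs3 k', ← h, hs3 k, inv_smul_smul₀ (hc k)]
    · intro k k' h
      have : k = k' := hpar k k' (c k') (hc k') (by rw [h, hs3])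
      exact hs1 k' (by rw [← h, this])
  have := Fintype.card_le_of_injective _ hinj
  rw [Fintype.card_sum, hcard] at this
  omega

theorem kh_ray_int {E : Type*} [NormedAddCommGroup E] [NormedSpace ℝ E] [FiniteDimensional ℝ E]
    (D : Set E) (hD : Convex ℝ D) (hi : (interior D).Nonempty) (hb : ¬ Bornology.IsBounded D) :
    ∃ u v : E, v ≠ 0 ∧ ∀ t : ℝ, 0 ≤ t → u + t • v ∈ D := by
  obtain ⟨u, hu⟩ := hi
  have hex : ∀ k : ℕ, ∃ y ∈ D, (k : ℝ) + 1 ≤ ‖y - u‖ := by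
    intro k
    by_contra! hc
    apply hb
    refine (Metric.isBounded_closedBall (x := u) (r := k + 1)).subset fun y hy => ?_
    rw [mem_closedBall_iff_norm]
    exact (hc y hy).le
  choose y hy hyk using hex
  have hpos : ∀ k, 0 < ‖y k - u‖ := fun k => lt_of_lt_of_le (by positivity) (hyk k)
  obtain ⟨v, hv, φ, hφ, hlim⟩ := (isCompact_sphere (0 : E) 1).tendsto_subseq
    (x := fun k => ‖y k - u‖⁻¹ • (y k - u)) (by
      intro k
      simp [norm_smul, (hpos k).ne'])
  have hv1 : ‖v‖ = 1 := by simpa using hv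
  refine ⟨u, v, by rintro rfl; simp at hv1, ?_⟩
  have hcl : ∀ t : ℝ, 0 ≤ t → u + t • v ∈ closure D := by
    intro t ht
    have h1 : Tendsto (fun k => u + t • (‖y (φ k) - u‖⁻¹ • (y (φ k) - u))) atTop (𝓝 (u + t • v)) :=
      tendsto_const_nhds.add (tendsto_const_nhds.smul hlim)
    refine mem_closure_of_tendsto h1 ?_
    obtain ⟨N, hN⟩ := exists_nat_ge t
    filter_upwards [eventually_ge_atTop N] with k hk
    have h2 : (N : ℝ) ≤ φ k := by exact_mod_cast hk.trans hφ.le_apply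
    have h3 := hyk (φ k)
    have h4 : t * ‖y (φ k) - u‖⁻¹ ≤ 1 := by
      rw [← div_eq_mul_inv, div_le_one (hpos _)]; linarith
    rw [smul_smul]
    exact hD.add_smul_sub_mem (interior_subset hu) (hy _) ⟨by positivity, h4⟩
  intro t ht
  have h2 := hcl (2 * t) (by positivity)
  apply interior_subset
  rcases ht.eq_or_lt with rfl | ht
  · simpa using hu
  apply hD.openSegment_interior_closure_subset_interior hu h2
  refine ⟨1/2, 1/2, by norm_num, by norm_num, by norm_num, ?_⟩
  module

theorem kh_ray {E : Type*} [NormedAddCommGroup E] [NormedSpace ℝ E] [FiniteDimensional ℝ E]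
    (D : Set E) (hD : Convex ℝ D) (hb : ¬ Bornology.IsBounded D) :
    ∃ u v : E, v ≠ 0 ∧ ∀ t : ℝ, 0 ≤ t → u + t • v ∈ D := by
  obtain ⟨x, hx⟩ : D.Nonempty := by
    rw [Set.nonempty_iff_ne_empty]; rintro rfl; simp at hb
  set D0 : Set E := (fun z => x + z) ⁻¹' D with hD0
  have hc0 : Convex ℝ D0 := hD.translate_preimage_right x
  have h0 : (0 : E) ∈ D0 := by simpa [hD0] using hx
  set V := Submodule.span ℝ D0
  set D1 : Set V := V.subtype ⁻¹' D0
  have hc1 : Convex ℝ D1 := hc0.linear_preimage _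
  have hi : (interior D1).Nonempty := by
    rw [hc1.interior_nonempty_iff_affineSpan_eq_top]
    have h01 : (0 : V) ∈ D1 := by simpa [D1] using h0
    have h2 : Submodule.span ℝ D1 = ⊤ := Submodule.span_span_coe_preimage
    rw [← Set.insert_eq_of_mem h01]
    apply SetLike.coe_injective
    rw [affineSpan_insert_zero, h2]; simp
  have hb1 : ¬ Bornology.IsBounded D1 := by
    intro hbd
    apply hb
    obtain ⟨R, hR⟩ := hbd.exists_norm_le
    refine (Metric.isBounded_closedBall (x := x) (r := R)).subset fun y hy => ?_
    rw [mem_closedBall_iff_norm]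
    have h3 : y - x ∈ D0 := by simpa [hD0] using hy
    exact hR ⟨y - x, Submodule.subset_span h3⟩ h3
  obtain ⟨u, v, hv, h⟩ := kh_ray_int D1 hc1 hi hb1
  refine ⟨x + u, v, by simpa using hv, fun t ht => ?_⟩
  have := h t ht
  simpa [D1, hD0, add_assoc] using this

theorem kh_far {ι E : Type*} [Fintype ι] [NormedAddCommGroup E] [NormedSpace ℝ E]
    [FiniteDimensional ℝ E] (hcard : 2 * Module.finrank ℝ E < Fintype.card ι)
    (p : ℕ → ι → E) (hp : ∀ (k : ℕ) i, (k : ℝ) + 1 ≤ ‖p k i‖) (R : ℝ) :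
    ∃ k, ∃ γ : ι → ℝ, ∑ i, γ i • p k i = 0 ∧ ∑ i, |γ i| ≤ 1 ∧ R ≤ ‖∑ i, |γ i| • p k i‖ := by
  classical
  set m := Fintype.card ι - Module.finrank ℝ E with hm
  have hpos : ∀ k i, 0 < ‖p k i‖ := fun k i => lt_of_lt_of_le (by positivity) (hp k i)
  set x : ℕ → ι → E := fun k i => ‖p k i‖⁻¹ • p k i with hxdef
  have hx1 : ∀ k i, ‖x k i‖ = 1 := by
    intro k i; simp [hxdef, norm_smul, (hpos k i).ne']
  have hw : ∀ k, ∃ w : Fin m → EuclideanSpace ℝ ι, Orthonormal ℝ w ∧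
      ∀ j, ∑ i, w j i • x k i = 0 := by
    intro k
    let T : EuclideanSpace ℝ ι →ₗ[ℝ] E :=
      ∑ i, (LinearMap.toSpanSingleton ℝ E (x k i)).comp
        (EuclideanSpace.proj i : EuclideanSpace ℝ ι →L[ℝ] ℝ).toLinearMap
    have hT : ∀ g, T g = ∑ i, g i • x k i := by intro g; simp [T]
    have h1 := T.finrank_range_add_finrank_ker
    have h2 : Module.finrank ℝ (LinearMap.range T) ≤ Module.finrank ℝ E := Submodule.finrank_le _
    rw [finrank_euclideanSpace] at h1
    have h3 : m ≤ Module.finrank ℝ (LinearMap.ker T) := by omega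
    let b := stdOrthonormalBasis ℝ (LinearMap.ker T)
    refine ⟨fun j => (b (Fin.castLE h3 j) : EuclideanSpace ℝ ι), ?_, ?_⟩
    · exact ((b.orthonormal.comp _ (Fin.castLE_injective h3)).comp_linearIsometry
        (LinearMap.ker T).subtypeₗᵢ)
    · intro j
      rw [← hT]
      exact (b (Fin.castLE h3 j)).2
  choose w hwo hwk using hw
  obtain ⟨⟨x', w'⟩, -, φ, hφ, hlim⟩ := tendsto_subseq_of_bounded
    (Metric.isBounded_closedBall (x := (0 : (ι → E) × (Fin m → EuclideanSpace ℝ ι))) (r := 1))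
    (x := fun k => (x k, w k)) (by
      intro k
      rw [mem_closedBall_zero_iff, Prod.norm_mk, max_le_iff]
      constructor
      · rw [pi_norm_le_iff_of_nonneg zero_le_one]
        intro i; exact (hx1 k i).le
      · rw [pi_norm_le_iff_of_nonneg zero_le_one]
        intro i; exact ((hwo k).1 i).le)
  have hlx : ∀ i, Tendsto (fun k => x (φ k) i) atTop (𝓝 (x' i)) := by
    intro i
    exact ((continuous_apply i).comp continuous_fst).continuousAt.tendsto.comp hlim
  have hlw : ∀ j, Tendsto (fun k => w (φ k) j) atTop (𝓝 (w' j)) := by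
    intro j
    exact ((continuous_apply j).comp continuous_snd).continuousAt.tendsto.comp hlim
  have hx'1 : ∀ i, x' i ≠ 0 := by
    intro i h
    have h1 := (hlx i).norm
    simp only [hx1] at h1
    have := tendsto_nhds_unique h1 tendsto_const_nhds
    simp [h] at this
  have hw'o : Orthonormal ℝ w' := by
    rw [orthonormal_iff_ite]
    intro a b
    have h1 : Tendsto (fun k => inner ℝ (w (φ k) a) (w (φ k) b)) atTop (𝓝 (inner ℝ (w' a) (w' b))) :=
      (hlw a).inner (hlw b)
    have h2 : ∀ k, inner ℝ (w (φ k) a) (w (φ k) b) = if a = b then (1 : ℝ) else 0 :=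
      fun k => orthonormal_iff_ite.mp (hwo (φ k)) a b
    simp only [h2] at h1
    exact tendsto_nhds_unique h1 tendsto_const_nhds |> fun h => by simpa using h
  let l : ι → (Fin m → ℝ) →ₗ[ℝ] ℝ := fun i => ∑ j, (w' j i) • LinearMap.proj j
  have hl : ∀ i a, l i a = ∑ j, a j * w' j i := by intro i a; simp [l, mul_comm]
  obtain ⟨a, ha⟩ : ∃ a, ∑ i, |l i a| • x' i ≠ 0 := by
    by_contra! hc
    have := kh_count l x' hx'1 (by
      intro a ha
      have h1 : ∑ j, a j • w' j = 0 := by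
        ext i
        have := ha i
        rw [hl] at this
        simpa using this
      ext j
      exact Fintype.linearIndependent_iff.mp hw'o.linearIndependent a h1 j) hc
    simp at this
    omega
  set y := ∑ i, |l i a| • x' i with hy
  set g : ℕ → ι → ℝ := fun k i => ∑ j, a j * w k j i with hg
  have hgx : ∀ k, ∑ i, g k i • x k i = 0 := by
    intro k
    simp only [hg, Finset.sum_smul, mul_smul]
    rw [Finset.sum_comm]
    simp only [← Finset.smul_sum, hwk]
    simp
  have hlg : ∀ i, Tendsto (fun k => g (φ k) i) atTop (𝓝 (l i a)) := by
    intro i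
    rw [hl]
    refine tendsto_finsetSum _ fun j _ => tendsto_const_nhds.mul ?_
    exact ((EuclideanSpace.proj i : EuclideanSpace ℝ ι →L[ℝ] ℝ).continuous.continuousAt.tendsto).comp
      (hlw j)
  have hly : Tendsto (fun k => ‖∑ i, |g (φ k) i| • x (φ k) i‖) atTop (𝓝 ‖y‖) :=
    (tendsto_finsetSum _ fun i _ => (hlg i).abs.smul (hlx i)).norm
  have hls : Tendsto (fun k => ∑ i, |g (φ k) i|) atTop (𝓝 (∑ i, |l i a|)) :=
    tendsto_finsetSum _ fun i _ => (hlg i).abs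
  set S := ∑ i, |l i a| with hS
  have hS0 : 0 ≤ S := Finset.sum_nonneg fun i _ => abs_nonneg _
  have hy0 : 0 < ‖y‖ := norm_pos_iff.mpr ha
  obtain ⟨N, hN⟩ := exists_nat_ge (R * (S + 1) / (‖y‖ / 2))
  obtain ⟨k, hk1, hk2, hk3⟩ := ((hly.eventually_const_lt (half_lt_self hy0)).and
    ((hls.eventually_lt_const (lt_add_one S)).and (eventually_ge_atTop N))).exists
  set K := φ k with hK
  have hKN : (N : ℝ) ≤ K := by exact_mod_cast hk3.trans hφ.le_apply
  refine ⟨K, fun i => (K / (S + 1)) * (g K i * ‖p K i‖⁻¹), ?_, ?_, ?_⟩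
  · simp only [mul_smul, ← Finset.smul_sum]
    have := hgx K
    simp only [hxdef] at this
    rw [this, smul_zero]
  · calc ∑ i, |(K / (S + 1)) * (g K i * ‖p K i‖⁻¹)| ≤ ∑ i, |g K i| / (S + 1) := by
          refine Finset.sum_le_sum fun i _ => ?_
          have h1 : (K : ℝ) * ‖p K i‖⁻¹ ≤ 1 := by
            rw [← div_eq_mul_inv, div_le_one (hpos K i)]
            linarith [hp K i]
          rw [abs_mul, abs_mul, abs_of_nonneg (by positivity : 0 ≤ (K : ℝ) / (S + 1)),
            abs_of_nonneg (by positivity : 0 ≤ ‖p K i‖⁻¹)]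
          calc (K : ℝ) / (S + 1) * (|g K i| * ‖p K i‖⁻¹)
              = |g K i| / (S + 1) * (K * ‖p K i‖⁻¹) := by ring
            _ ≤ |g K i| / (S + 1) * 1 := by gcongr
            _ = _ := mul_one _
      _ ≤ 1 := by
          rw [← Finset.sum_div, div_le_one (by positivity)]
          exact hk2.le
  · have h1 : ∑ i, |(K / (S + 1)) * (g K i * ‖p K i‖⁻¹)| • p K i
        = (K / (S + 1)) • ∑ i, |g K i| • x K i := by
      rw [Finset.smul_sum]
      refine Finset.sum_congr rfl fun i _ => ?_
      rw [abs_mul, abs_mul, abs_of_nonneg (by positivity : 0 ≤ (K : ℝ) / (S + 1)),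
            abs_of_nonneg (by positivity : 0 ≤ ‖p K i‖⁻¹), mul_smul, mul_smul]
    rw [h1, norm_smul, Real.norm_of_nonneg (by positivity)]
    have h2 : R * (S + 1) / (‖y‖ / 2) ≤ K := hN.trans hKN
    rw [div_le_iff₀ (by positivity)] at h2
    have h3 : R ≤ K * (‖y‖ / 2) / (S + 1) := by
      rw [le_div_iff₀ (by positivity)]; exact h2
    calc R ≤ K * (‖y‖ / 2) / (S + 1) := h3
      _ = K / (S + 1) * (‖y‖ / 2) := by ring
      _ ≤ _ := by gcongr

theorem kh_comb {ι E : Type*} [Fintype ι] [AddCommGroup E] [Module ℝ E] {C : Set E}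
    (hC : Convex ℝ C) (h0 : (0 : E) ∈ C) (c : ι → ℝ) (p : ι → E) (hc : ∀ i, 0 ≤ c i)
    (hs : ∑ i, c i ≤ 1) (hp : ∀ i, c i ≠ 0 → p i ∈ C) : ∑ i, c i • p i ∈ C := by
  classical
  have h : ∑ i, c i • p i = ∑ i : Option ι, (i.elim (1 - ∑ i, c i) c) •
      (i.elim 0 (fun i => if c i = 0 then 0 else p i)) := by
    rw [Fintype.sum_option]
    simp only [Option.elim, smul_zero, zero_add]
    refine Finset.sum_congr rfl fun i _ => ?_
    split_ifs with h <;> simp [h]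
  rw [h]
  refine hC.sum_mem ?_ ?_ ?_
  · rintro (_ | i) _
    · simpa using hs
    · exact hc i
  · rw [Fintype.sum_option]; simp
  · rintro (_ | i) _
    · exact h0
    · by_cases h : c i = 0
      · simpa [h] using h0
      · simpa [h] using hp i h

theorem kh_step {ι E : Type*} [Fintype ι] [NormedAddCommGroup E] [NormedSpace ℝ E]
    [FiniteDimensional ℝ E] (hcard : 2 * Module.finrank ℝ E < Fintype.card ι)
    (C : ι → Set E) (hC : ∀ i, Convex ℝ (C i)) (h0 : ∀ i, (0 : E) ∈ C i)
    (hb : ∀ i, ¬ Bornology.IsBounded (⋂ j, ⋂ (_ : j ≠ i), C j)) :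
    ¬ Bornology.IsBounded (⋂ j, C j) := by
  have hex : ∀ (k : ℕ) (i : ι), ∃ y, (∀ j, j ≠ i → y ∈ C j) ∧ (k : ℝ) + 1 ≤ ‖y‖ := by
    intro k i
    by_contra! hc
    apply hb i
    refine (Metric.isBounded_closedBall (x := (0 : E)) (r := k + 1)).subset fun y hy => ?_
    rw [mem_closedBall_zero_iff]
    exact (hc y (by simpa using hy)).le
  choose p hpC hp using hex
  intro hbd
  obtain ⟨R, hR⟩ := hbd.exists_norm_le
  obtain ⟨k, γ, h1, h2, h3⟩ := kh_far hcard p hp (2 * R + 1)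
  have e1 : ∑ i, ((|γ i| + γ i) / 2) • p k i = (1 / 2 : ℝ) • ∑ i, |γ i| • p k i := by
    rw [← add_zero (∑ i, |γ i| • p k i), ← h1, ← Finset.sum_add_distrib, Finset.smul_sum]
    refine Finset.sum_congr rfl fun i _ => ?_
    module
  have e2 : ∑ i, ((|γ i| - γ i) / 2) • p k i = (1 / 2 : ℝ) • ∑ i, |γ i| • p k i := by
    rw [← sub_zero (∑ i, |γ i| • p k i), ← h1, ← Finset.sum_sub_distrib, Finset.smul_sum]
    refine Finset.sum_congr rfl fun i _ => ?_
    module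
  have hz : (1 / 2 : ℝ) • ∑ i, |γ i| • p k i ∈ ⋂ j, C j := by
    rw [Set.mem_iInter]
    intro j
    rcases le_total (γ j) 0 with hj | hj
    · rw [← e1]
      refine kh_comb (hC j) (h0 j) _ _ (fun i => ?_) ?_ (fun i hi => hpC k i j ?_)
      · linarith [neg_abs_le (γ i)]
      · exact (Finset.sum_le_sum fun i _ => by linarith [le_abs_self (γ i)]).trans h2
      · rintro rfl
        exact hi (by rw [abs_of_nonpos hj]; ring)
    · rw [← e2]
      refine kh_comb (hC j) (h0 j) _ _ (fun i => ?_) ?_ (fun i hi => hpC k i j ?_)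
      · linarith [le_abs_self (γ i)]
      · exact (Finset.sum_le_sum fun i _ => by linarith [neg_abs_le (γ i)]).trans h2
      · rintro rfl
        exact hi (by rw [abs_of_nonneg hj]; ring)
  have h4 := hR _ hz
  rw [norm_smul] at h4
  norm_num at h4
  linarith

theorem kh_ray_unbounded {E : Type*} [NormedAddCommGroup E] [NormedSpace ℝ E] {D : Set E}
    {u v : E} (hv : v ≠ 0) (h : {x | ∃ t : ℝ, 0 ≤ t ∧ x = u + t • v} ⊆ D) :
    ¬ Bornology.IsBounded D := by
  intro hbd
  obtain ⟨R, hR⟩ := hbd.exists_norm_le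
  have hv0 : 0 < ‖v‖ := norm_pos_iff.mpr hv
  have hR0 : 0 ≤ R := (norm_nonneg _).trans (hR u (h ⟨0, le_rfl, by simp⟩))
  have h1 := hR _ (h ⟨(R + ‖u‖ + 1) / ‖v‖, by positivity, rfl⟩)
  have h2 := norm_sub_le (u + ((R + ‖u‖ + 1) / ‖v‖) • v) u
  rw [add_sub_cancel_left, norm_smul, Real.norm_of_nonneg (by positivity),
    div_mul_cancel₀ _ hv0.ne'] at h2
  linarith



/-- Katchalski's theorem: if every subfamily of size at most `2d` of a finite family of
convex sets in `ℝ^d` has an intersection containing a halfline, then so does the whole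
intersection. -/
theorem katchalski_halfline (d : ℕ)
    (𝒞 : Finset (Set (EuclideanSpace ℝ (Fin d))))
    (hconv : ∀ C ∈ 𝒞, Convex ℝ C)
    (H : ∀ 𝒞' ⊆ 𝒞, 𝒞'.card ≤ 2 * d →
      ∃ u v : EuclideanSpace ℝ (Fin d), v ≠ 0 ∧
        {x | ∃ t : ℝ, 0 ≤ t ∧ x = u + t • v} ⊆ ⋂₀ (𝒞' : Set (Set (EuclideanSpace ℝ (Fin d))))) :
    ∃ u v : EuclideanSpace ℝ (Fin d), v ≠ 0 ∧
      {x | ∃ t : ℝ, 0 ≤ t ∧ x = u + t • v} ⊆ ⋂₀ (𝒞 : Set (Set (EuclideanSpace ℝ (Fin d)))) := by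
  classical
  rcases Nat.eq_zero_or_pos d with rfl | hd
  · obtain ⟨u, v, hv, -⟩ := H ∅ (by simp) (by simp)
    exact absurd (Subsingleton.elim v 0) hv
  have hmain : ∀ n, ∀ F : Finset (Set (EuclideanSpace ℝ (Fin d))), F ⊆ 𝒞 → F.card = n →
      ¬ Bornology.IsBounded (⋂₀ (F : Set (Set (EuclideanSpace ℝ (Fin d))))) := by
    intro n
    induction n with
    | zero =>
      intro F hF hn
      obtain ⟨u, v, hv, h⟩ := H F hF (by omega)
      exact kh_ray_unbounded hv h
    | succ n ih =>
      intro F hF hn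
      by_cases hle : F.card ≤ 2 * d
      · obtain ⟨u, v, hv, h⟩ := H F hF hle
        exact kh_ray_unbounded hv h
      obtain ⟨z, hz⟩ := Convex.helly_theorem_set' (𝕜 := ℝ) (F := F) (fun X hX => hconv X (hF hX)) (by
        intro G hG hGc
        rw [finrank_euclideanSpace_fin] at hGc
        obtain ⟨u, v, hv, h⟩ := H G (hG.trans hF) (by omega)
        exact ⟨u, h ⟨0, le_rfl, by simp⟩⟩)
      have hst := kh_step (ι := F) (E := EuclideanSpace ℝ (Fin d))
        (by rw [finrank_euclideanSpace_fin, Fintype.card_coe]; omega)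
        (fun X => (fun y => z + y) ⁻¹' X.1)
        (fun X => (hconv X.1 (hF X.2)).translate_preimage_right z)
        (fun X => by simpa using hz X.1 X.2) (by
          intro X hbd
          refine ih (F.erase X.1) ((Finset.erase_subset _ _).trans hF)
            (by rw [Finset.card_erase_of_mem X.2]; omega) ?_
          obtain ⟨R, hR⟩ := hbd.exists_norm_le
          refine (Metric.isBounded_closedBall (x := z) (r := R)).subset fun y hy => ?_
          rw [mem_closedBall_iff_norm]
          refine hR _ ?_
          simp only [Set.mem_iInter, Set.mem_preimage, add_sub_cancel]
          intro Y hY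
          exact hy Y.1 (by simpa using fun h => hY (Subtype.ext h)))
      intro hbd
      apply hst
      obtain ⟨R, hR⟩ := hbd.exists_norm_le
      refine (Metric.isBounded_closedBall (x := -z) (r := R)).subset fun y hy => ?_
      rw [mem_closedBall_iff_norm]
      refine hR _ ?_
      intro Y hY
      have := Set.mem_iInter.mp hy ⟨Y, hY⟩
      simpa [add_comm] using this
  obtain ⟨u, v, hv, h⟩ := kh_ray _ (convex_sInter fun X hX => hconv X hX) (hmain _ 𝒞 subset_rfl rfl)
  refine ⟨u, v, hv, ?_⟩
  rintro x ⟨t, ht, rfl⟩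
  exact h t ht
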